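/- Let d < 0 be a negative fundamental discriminant whose factorization into pairwise coprime prime discriminants d = q_1*·…·q_t* has q_1*, …, q_{t−1}* odd and q_t* ∈ {−4, −8}, numbered so that q_i* > 0 for 1 ≤ i ≤ u and q_i* < 0 for u < i ≤ t, where 0 ≤ u ≤ t−2. In ℂ set α_i = (1 + √q_i*)/2 and ᾱ_i = (1 − √q_i*)/2 for i ≤ t−1, and α_t = √(q_t*/4) (i.e. i or i√2), and let K_G = ℚ(√q_1*, …, √q_t*) ⊂ ℂ with ring of integers 𝓞. For s ∈ {0,1}^{t−1} define β_s = (∏_{i=1}^{u} ᾱ_i^{s_i}·α_i^{1−s_i}) · ( (∏_{i=u+1}^{t−2} ᾱ_i^{s_i}·α_i^{1−s_i})·α_{t−1}·α_t^{s_{t−1}} + (∏_{i=u+1}^{t−2} ᾱ_i^{1−s_i}·α_i^{s_i})·ᾱ_{t−1}·(−α_t)^{s_{t−1}} ) and β*_s = (∏_{i=1}^{u} (−ᾱ_i)^{s_i}·α_i^{1−s_i}) · ( (∏_{i=u+1}^{t−2} (−ᾱ_i)^{s_i}·α_i^{1−s_i})·α_{t−1}·α_t^{1−s_{t−1}} −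 (∏_{i=u+1}^{t−2} ᾱ_i^{1−s_i}·(−α_i)^{s_i})·ᾱ_{t−1}·(−α_t)^{1−s_{t−1}} ). Then: (1) the numbers β_s form a ℤ-basis of 𝓞 ∩ ℝ; (2) the numbers β*_s form a ℤ-basis of the ℤ-module 𝓞 ∩ iℝ; (3) if for each μ ∈ {0,1}^{t−1}, τ_μ is a ℚ-algebra automorphism of K_G with τ_μ(√q_i*) = (−1)^{μ_i}·√q_i* for 1 ≤ i ≤ t−1 and τ_μ(√q_t*) = √q_t*, then for all η, ν ∈ {0,1}^{t−1}, ∑_{μ} (−1)^{μ_1+…+μ_{t−1}} τ_μ(β_η·β*_ν) equals √q_1*·…·√q_t* if η = ν and 0 otherwise. -/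

import Mathlib

/-- The square root of a real number inside `ℂ`: for a negative real `x`,
`√x` denotes `i·√|x|`. -/
noncomputable def csqrt (x : ℝ) : ℂ :=
  if x < 0 then Complex.I * Real.sqrt (-x) else Real.sqrt x

/-- A negative fundamental discriminant. -/
def IsNegFundamentalDiscriminant (d : ℤ) : Prop :=
  d < 0 ∧ ((d % 4 = 1 ∧ Squarefree d) ∨
    (d % 4 = 0 ∧ Squarefree (d / 4) ∧ d / 4 % 4 ≠ 1))

/-- A prime discriminant. -/
def IsPrimeDiscriminant (q : ℤ) : Prop :=
  (∃ p : ℕ, p.Prime ∧ Odd p ∧ q = (-1) ^ ((p - 1) / 2) * (p : ℤ)) ∨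
    q = -4 ∨ q = 8 ∨ q = -8

/-- A family `e` of complex numbers is a `ℤ`-basis of `𝓞 ∩ ℝ`. -/
def IsIntBasisReal {ι : Type*} (M : IntermediateField ℚ ℂ) (e : ι → ℂ) : Prop :=
  (∀ s, e s ∈ M) ∧ (∀ s, IsIntegral ℤ (e s)) ∧ (∀ s, (e s).im = 0) ∧
    LinearIndependent ℤ e ∧
    ∀ x : ℂ, x ∈ M → IsIntegral ℤ x → x.im = 0 → x ∈ Submodule.span ℤ (Set.range e)

/-- A family `e` of complex numbers is a `ℤ`-basis of the `ℤ`-module `𝓞 ∩ iℝ`. -/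
def IsIntBasisImag {ι : Type*} (M : IntermediateField ℚ ℂ) (e : ι → ℂ) : Prop :=
  (∀ s, e s ∈ M) ∧ (∀ s, IsIntegral ℤ (e s)) ∧ (∀ s, (e s).re = 0) ∧
    LinearIndependent ℤ e ∧
    ∀ x : ℂ, x ∈ M → IsIntegral ℤ x → x.re = 0 → x ∈ Submodule.span ℤ (Set.range e)

section SignProducts

variable {n : ℕ} {F : Type*} [Field F]

/-- The product basis of `⨂ ℤ[(1 + r i) / 2]` formed by the elements `(1 ± r i) / 2`. -/
noncomputable def signBasis (r : Fin n → F) (s : Fin n → Fin 2) : F :=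
  ∏ i, (1 + (-1) ^ (s i : ℕ) * r i) / 2

/-- The family dual to `signBasis` for the twisted trace form. -/
noncomputable def signDual (r : Fin n → F) (s : Fin n → Fin 2) : F :=
  ∏ i, ((-1) ^ (s i : ℕ) + r i) / 2

/-- The family obtained from `r` by negating the members outside `p`. -/
def conjFamily (p : Fin n → Prop) [DecidablePred p] (r : Fin n → F) (i : Fin n) : F :=
  if p i then r i else -r i

/-- The index obtained from `s` by flipping the entries outside `p`. -/
def conjIndex (p : Fin n → Prop) [DecidablePred p] (s : Fin n → Fin 2) (i : Fin n) : Fin 2 :=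
  if p i then s i else 1 - s i

/-- The abstract form of the basis of the integers fixed by complex conjugation. -/
noncomputable def realFamily (p : Fin n → Prop) [DecidablePred p] (l : Fin n) (r : Fin n → F)
    (a : F) (s : Fin n → Fin 2) : F :=
  signBasis r (Function.update s l 0) * a ^ (s l : ℕ) +
    signBasis (conjFamily p r) (Function.update s l 0) * (-a) ^ (s l : ℕ)

/-- The abstract form of the basis of the integers negated by complex conjugation. -/
noncomputable def imagFamily (p : Fin n → Prop) [DecidablePred p] (l : Fin n) (r : Fin n → F)
    (a : F) (s : Fin n → Fin 2) : F :=
  signDual r (Function.update s l 0) * a ^ (1 - (s l : ℕ)) -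
    signDual (conjFamily p r) (Function.update s l 0) * (-a) ^ (1 - (s l : ℕ))

variable (p : Fin n → Prop) [DecidablePred p]

theorem map_signBasis {F' : Type*} [Field F'] (f : F →+* F') (r : Fin n → F)
    (s : Fin n → Fin 2) : f (signBasis r s) = signBasis (fun i => f (r i)) s := by
  simp [signBasis, map_prod, map_ofNat f 2]

theorem map_signDual {F' : Type*} [Field F'] (f : F →+* F') (r : Fin n → F)
    (s : Fin n → Fin 2) : f (signDual r s) = signDual (fun i => f (r i)) s := by
  simp [signDual, map_prod, map_ofNat f 2]

theorem map_conjFamily {F' : Type*} [Field F'] (f : F →+* F') (r : Fin n → F) :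
    (fun i => f (conjFamily p r i)) = conjFamily p fun i => f (r i) := by
  funext i
  by_cases h : p i <;> simp [conjFamily, h]

theorem map_realFamily {F' : Type*} [Field F'] (f : F →+* F') (l : Fin n) (r : Fin n → F) (a : F)
    (s : Fin n → Fin 2) :
    f (realFamily p l r a s) = realFamily p l (fun i => f (r i)) (f a) s := by
  simp only [realFamily, map_add, map_mul, map_pow, map_neg, map_signBasis, map_conjFamily]

theorem map_imagFamily {F' : Type*} [Field F'] (f : F →+* F') (l : Fin n) (r : Fin n → F) (a : F)
    (s : Fin n → Fin 2) :
    f (imagFamily p l r a s) = imagFamily p l (fun i => f (r i)) (f a) s := by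
  simp only [imagFamily, map_sub, map_mul, map_pow, map_neg, map_signDual, map_conjFamily]

theorem signBasis_conjFamily (r : Fin n → F) (s : Fin n → Fin 2) :
    signBasis (conjFamily p r) s = signBasis r (conjIndex p s) := by
  refine Finset.prod_congr rfl fun i _ => ?_
  by_cases h : p i
  · simp [conjFamily, conjIndex, h]
  · simp only [conjFamily, conjIndex, h, if_false]
    generalize s i = j
    fin_cases j <;> simp

theorem signDual_eq_prod_mul (r : Fin n → F) (hr : ∀ i, r i ≠ 0) (s : Fin n → Fin 2) :
    signDual r s = (∏ i, r i) * signBasis (fun i => (r i)⁻¹) s := by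
  rw [signBasis, ← Finset.prod_mul_distrib]
  refine Finset.prod_congr rfl fun i _ => ?_
  have := hr i
  field_simp
  ring

theorem signDual_eq_sign_mul (r : Fin n → F) (s : Fin n → Fin 2) :
    signDual r s = (-1) ^ (∑ i, (s i : ℕ)) * signBasis r s := by
  rw [signBasis, ← Finset.prod_pow_eq_pow_sum, ← Finset.prod_mul_distrib]
  refine Finset.prod_congr rfl fun i _ => ?_
  generalize s i = j
  fin_cases j
  · simp
  · simp
    ring

theorem conjFamily_inv (r : Fin n → F) :
    conjFamily p (fun i => (r i)⁻¹) = fun i => (conjFamily p r i)⁻¹ := by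
  funext i
  by_cases h : p i <;> simp [conjFamily, h, inv_neg]

theorem signDual_conjFamily (r : Fin n → F) (hr : ∀ i, r i ≠ 0)
    (hP : ∏ i, conjFamily p r i = ∏ i, r i) (s : Fin n → Fin 2) :
    signDual (conjFamily p r) s = signDual r (conjIndex p s) := by
  rw [signDual_eq_prod_mul _ hr, signDual_eq_prod_mul, hP, ← conjFamily_inv, signBasis_conjFamily]
  intro i
  by_cases h : p i <;> simp [conjFamily, h, hr]

theorem conjIndex_conjIndex (s : Fin n → Fin 2) : conjIndex p (conjIndex p s) = s := by
  funext i
  by_cases h : p i <;> simp [conjIndex, h]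

theorem conjIndex_inj {s s' : Fin n → Fin 2} : conjIndex p s = conjIndex p s' ↔ s = s' :=
  ⟨fun h => by rw [← conjIndex_conjIndex p s, h, conjIndex_conjIndex], fun h => by rw [h]⟩

theorem update_ne_conjIndex_update {l : Fin n} (hl : ¬ p l) (s s' : Fin n → Fin 2) :
    Function.update s l 0 ≠ conjIndex p (Function.update s' l 0) := by
  intro h
  simpa [conjIndex, hl] using congrFun h l

variable [CharZero F]

theorem sum_signBasis_mul_signBasis (r r' : Fin n → F) :
    ∑ s, signBasis r s * signBasis r' s = ∏ i, (1 + r i * r' i) / 2 := by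
  simp only [signBasis, ← Finset.prod_mul_distrib]
  rw [← Fintype.prod_sum fun i (j : Fin 2) =>
    (1 + (-1) ^ (j : ℕ) * r i) / 2 * ((1 + (-1) ^ (j : ℕ) * r' i) / 2)]
  refine Finset.prod_congr rfl fun i _ => ?_
  simp only [Fin.sum_univ_two]
  simp
  ring

/-- The twisted trace pairing of `signBasis` and `signDual`, relative to a family of ring
homomorphisms realizing all sign changes of `r`. -/
theorem sum_twisted_signBasis_mul_signDual (r : Fin n → F) (c : F)
    (τ : (Fin n → Fin 2) → F →+* F) (hτ : ∀ μ i, τ μ (r i) = (-1) ^ (μ i : ℕ) * r i)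
    (hc : ∀ μ, τ μ c = c) (s s' : Fin n → Fin 2) :
    ∑ μ, (-1) ^ (∑ i, (μ i : ℕ)) * τ μ (signBasis r s * signDual r s' * c) =
      if s = s' then (∏ i, r i) * c else 0 := by
  have key : ∀ μ : Fin n → Fin 2,
      (-1) ^ (∑ i, (μ i : ℕ)) * τ μ (signBasis r s * signDual r s' * c) =
      (∏ i, (-1) ^ (μ i : ℕ) * ((1 + (-1) ^ (s i : ℕ) * ((-1) ^ (μ i : ℕ) * r i)) / 2 *
        (((-1) ^ (s' i : ℕ) + (-1) ^ (μ i : ℕ) * r i) / 2))) * c := by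
    intro μ
    rw [map_mul, map_mul, hc, map_signBasis, map_signDual, Finset.prod_mul_distrib,
      Finset.prod_mul_distrib, Finset.prod_pow_eq_pow_sum]
    simp only [hτ, signBasis, signDual]
    ring
  simp only [key, ← Finset.sum_mul]
  rw [← Fintype.prod_sum fun i (j : Fin 2) =>
    (-1) ^ (j : ℕ) * ((1 + (-1) ^ (s i : ℕ) * ((-1) ^ (j : ℕ) * r i)) / 2 *
        (((-1) ^ (s' i : ℕ) + (-1) ^ (j : ℕ) * r i) / 2))]
  have fac : ∀ i, ∑ j : Fin 2,
      (-1) ^ (j : ℕ) * ((1 + (-1) ^ (s i : ℕ) * ((-1) ^ (j : ℕ) * r i)) / 2 *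
        (((-1) ^ (s' i : ℕ) + (-1) ^ (j : ℕ) * r i) / 2)) = if s i = s' i then r i else 0 := by
    intro i
    generalize s i = j
    generalize s' i = j'
    fin_cases j <;> fin_cases j' <;> simp [Fin.sum_univ_two] <;> ring
  simp only [fac]
  split_ifs with h
  · simp [h]
  · obtain ⟨i, hi⟩ := Function.ne_iff.1 h
    rw [Finset.prod_eq_zero (Finset.mem_univ i) (if_neg hi), zero_mul]

theorem sum_twisted_realFamily_mul_imagFamily (r : Fin n → F) (hr : ∀ i, r i ≠ 0) (a : F)
    {l : Fin n} (hl : ¬ p l) (hP : ∏ i, conjFamily p r i = ∏ i, r i)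
    (τ : (Fin n → Fin 2) → F →+* F) (hτ : ∀ μ i, τ μ (r i) = (-1) ^ (μ i : ℕ) * r i)
    (ha : ∀ μ, τ μ a = a) (η ν : Fin n → Fin 2) :
    ∑ μ, (-1) ^ (∑ i, (μ i : ℕ)) * τ μ (realFamily p l r a η * imagFamily p l r a ν) =
      if η = ν then (∏ i, r i) * (2 * a) else 0 := by
  have hfix : ∀ j k : ℕ, ∀ x y : F, (x = a ∨ x = -a) → (y = a ∨ y = -a) →
      ∀ μ, τ μ (x ^ j * y ^ k) = x ^ j * y ^ k := by
    rintro j k x y (rfl | rfl) (rfl | rfl) μ <;> simp [ha]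
  have base := fun (j k : ℕ) (x y : F) (hx : x = a ∨ x = -a) (hy : y = a ∨ y = -a) =>
    sum_twisted_signBasis_mul_signDual r (x ^ j * y ^ k) τ hτ (hfix j k x y hx hy)
  set θ := Function.update η l 0 with hθ
  set θ' := Function.update ν l 0 with hθ'
  have expand : realFamily p l r a η * imagFamily p l r a ν =
      signBasis r θ * signDual r θ' * (a ^ (η l : ℕ) * a ^ (1 - (ν l : ℕ))) -
      signBasis r θ * signDual r (conjIndex p θ') * (a ^ (η l : ℕ) * (-a) ^ (1 - (ν l : ℕ))) +
      signBasis r (conjIndex p θ) * signDual r θ' * ((-a) ^ (η l : ℕ) * a ^ (1 - (ν l : ℕ))) -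
      signBasis r (conjIndex p θ) * signDual r (conjIndex p θ') *
        ((-a) ^ (η l : ℕ) * (-a) ^ (1 - (ν l : ℕ))) := by
    rw [realFamily, imagFamily, signBasis_conjFamily, signDual_conjFamily p r hr hP]
    ring
  simp only [expand, map_sub, map_add, mul_sub, mul_add, Finset.sum_sub_distrib,
    Finset.sum_add_distrib]
  rw [base _ _ _ _ (Or.inl rfl) (Or.inl rfl), base _ _ _ _ (Or.inl rfl) (Or.inr rfl),
    base _ _ _ _ (Or.inr rfl) (Or.inl rfl), base _ _ _ _ (Or.inr rfl) (Or.inr rfl),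
    if_neg (update_ne_conjIndex_update p hl η ν),
    if_neg (Ne.symm (update_ne_conjIndex_update p hl ν η))]
  simp only [conjIndex_inj]
  have hiff : η = ν ↔ θ = θ' ∧ η l = ν l := by
    refine ⟨fun h => ?_, fun ⟨h, h'⟩ => ?_⟩
    · subst h; exact ⟨rfl, rfl⟩
    · funext i
      rcases eq_or_ne i l with rfl | hi
      · exact h'
      · simpa [hθ, hθ', hi] using congrFun h i
  by_cases h : θ = θ'
  · simp only [hiff, h, true_and, if_true]
    generalize η l = j
    generalize ν l = k
    fin_cases j <;> fin_cases k <;> simp <;> ring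
  · simp [hiff, h]

end SignProducts

section Independence

variable {n : ℕ} {F : Type*} [Field F] [CharZero F] (p : Fin n → Prop) [DecidablePred p]

theorem linearIndependent_realFamily (r : Fin n → F) (hr : ∀ i, r i ≠ 0) {a : F} (ha₀ : a ≠ 0)
    {l : Fin n} (hl : ¬ p l) (hP : ∏ i, conjFamily p r i = ∏ i, r i)
    (τ : (Fin n → Fin 2) → F →+* F) (hτ : ∀ μ i, τ μ (r i) = (-1) ^ (μ i : ℕ) * r i)
    (ha : ∀ μ, τ μ a = a) : LinearIndependent ℤ (realFamily p l r a) := by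
  refine Fintype.linearIndependent_iff.2 fun g hg ν => ?_
  have h : ∑ μ, (-1) ^ (∑ i, (μ i : ℕ)) *
      τ μ ((∑ η, g η • realFamily p l r a η) * imagFamily p l r a ν) =
      g ν * ((∏ i, r i) * (2 * a)) := by
    simp only [Finset.sum_mul, map_sum, Finset.mul_sum]
    rw [Finset.sum_comm]
    have := fun η => sum_twisted_realFamily_mul_imagFamily p r hr a hl hP τ hτ ha η ν
    simp only [zsmul_eq_mul, mul_assoc, map_mul (τ _) (g _ : F), map_intCast,
      mul_left_comm _ (g _ : F), ← Finset.mul_sum, this]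
    simp
  rw [hg] at h
  simpa [ha₀, Finset.prod_eq_zero_iff, hr] using h.symm

theorem linearIndependent_imagFamily (r : Fin n → F) (hr : ∀ i, r i ≠ 0) {a : F} (ha₀ : a ≠ 0)
    {l : Fin n} (hl : ¬ p l) (hP : ∏ i, conjFamily p r i = ∏ i, r i)
    (τ : (Fin n → Fin 2) → F →+* F) (hτ : ∀ μ i, τ μ (r i) = (-1) ^ (μ i : ℕ) * r i)
    (ha : ∀ μ, τ μ a = a) : LinearIndependent ℤ (imagFamily p l r a) := by
  refine Fintype.linearIndependent_iff.2 fun g hg η => ?_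
  have h : ∑ μ, (-1) ^ (∑ i, (μ i : ℕ)) *
      τ μ (realFamily p l r a η * (∑ ν, g ν • imagFamily p l r a ν)) =
      g η * ((∏ i, r i) * (2 * a)) := by
    simp only [Finset.mul_sum, map_sum]
    rw [Finset.sum_comm]
    have := fun ν => sum_twisted_realFamily_mul_imagFamily p r hr a hl hP τ hτ ha η ν
    simp only [zsmul_eq_mul, mul_left_comm _ (g _ : F), map_mul (τ _) (g _ : F), map_intCast,
      ← Finset.mul_sum, this]
    simp
  rw [hg] at h
  simpa [ha₀, Finset.prod_eq_zero_iff, hr] using h.symm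

end Independence

section Integrality

variable {F : Type*} [Field F] [Algebra ℚ F]

theorem Rat.exists_intCast_of_isIntegral_algebraMap {x : ℚ} (h : IsIntegral ℤ (algebraMap ℚ F x)) :
    ∃ m : ℤ, x = m := by
  rw [isIntegral_algebraMap_iff (algebraMap ℚ F).injective] at h
  obtain ⟨m, hm⟩ := IsIntegrallyClosed.isIntegral_iff.1 h
  exact ⟨m, by simpa using hm.symm⟩

theorem Rat.exists_intCast_of_squarefree_mul_sq {D : ℤ} (hD : Squarefree D) {x : ℚ} {m : ℤ}
    (h : D * x ^ 2 = m) : ∃ k : ℤ, x = k := by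
  have hden : (x.den : ℚ) ≠ 0 := by exact_mod_cast x.den_nz
  have h1 : D * x.num ^ 2 = m * (x.den : ℤ) ^ 2 := by
    have : (D : ℚ) * x.num ^ 2 = m * (x.den : ℚ) ^ 2 := by
      rw [← h, mul_assoc, ← mul_pow, Rat.mul_den_eq_num]
    exact_mod_cast this
  have hcop : IsCoprime ((x.den : ℤ) ^ 2) (x.num ^ 2) := by
    refine IsCoprime.pow ?_
    rw [Int.isCoprime_iff_nat_coprime]
    simpa using x.reduced.symm
  have hdvd : (x.den : ℤ) ^ 2 ∣ D := hcop.dvd_of_dvd_mul_right ⟨m, by rw [h1, mul_comm]⟩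
  rw [pow_two] at hdvd
  have hunit := hD _ hdvd
  have : x.den = 1 := by simpa [Int.isUnit_iff_natAbs_eq] using hunit
  exact ⟨x.num, (Rat.den_eq_one_iff x).1 this |>.symm⟩

/-- The local condition at two: half-integers `R / 2`, `S / 2` with `D (R² + e S²) / 4` integral
are integers, for odd `D` and `e ∈ {1, 2}`. -/
theorem Int.even_of_four_dvd_mul_sq_add {D e R S : ℤ} (hD : Odd D) (he : e = 1 ∨ e = 2)
    (h : 4 ∣ D * (R ^ 2 + e * S ^ 2)) : Even R ∧ Even S := by
  have hcop : IsCoprime (4 : ℤ) D := by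
    have : IsCoprime (2 : ℤ) D := (Int.isCoprime_two_left).2 hD
    simpa using this.pow_left (m := 2)
  have h4 := hcop.dvd_of_dvd_mul_left h
  rcases Int.even_or_odd' R with ⟨x, rfl | rfl⟩ <;> rcases Int.even_or_odd' S with ⟨y, rfl | rfl⟩ <;>
    rcases he with rfl | rfl <;> ring_nf at h4 <;> first | (exfalso; omega) | exact ⟨by simp, by simp⟩

theorem exists_intCast_coeff {D e : ℤ} (hD : Odd D) (hsf : Squarefree (e * D))
    (he : e = 1 ∨ e = 2) {P a : F} (hP : P ^ 2 = D) (ha : a ^ 2 = -e) (κ : F ≃ₐ[ℚ] F)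
    (hκP : κ P = P) (hκa : κ a = -a) {x y : ℚ}
    (h : IsIntegral ℤ (P * (algebraMap ℚ F x + algebraMap ℚ F y * a))) :
    ∃ m k : ℤ, x = m ∧ y = k := by
  set w := P * (algebraMap ℚ F x + algebraMap ℚ F y * a) with hw
  have hκw : κ w = P * (algebraMap ℚ F x - algebraMap ℚ F y * a) := by
    simp [hw, hκP, hκa, sub_eq_add_neg]
  have hiκ : IsIntegral ℤ (κ w) := h.map (κ.toAlgHom.restrictScalars ℤ)
  have hea : (e : F) = -a ^ 2 := by rw [ha, neg_neg]
  have hA' : (w + κ w) ^ 2 = algebraMap ℚ F (D * (2 * x) ^ 2) := by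
    rw [hκw, hw]
    push_cast [map_mul, map_pow, map_intCast, map_ofNat, ← hP]
    ring
  have hB' : -(w - κ w) ^ 2 = algebraMap ℚ F ((e * D : ℤ) * (2 * y) ^ 2) := by
    rw [hκw, hw]
    push_cast [map_mul, map_pow, map_intCast, map_ofNat, ← hP, hea]
    ring
  have hC' : w * κ w = algebraMap ℚ F (D * (x ^ 2 + e * y ^ 2)) := by
    rw [hκw, hw]
    push_cast [map_mul, map_add, map_pow, map_intCast, ← hP, hea]
    ring
  obtain ⟨A, hA⟩ := Rat.exists_intCast_of_isIntegral_algebraMap (hA' ▸ (h.add hiκ).pow 2)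
  obtain ⟨B, hB⟩ := Rat.exists_intCast_of_isIntegral_algebraMap (hB' ▸ ((h.sub hiκ).pow 2).neg)
  obtain ⟨C, hC⟩ := Rat.exists_intCast_of_isIntegral_algebraMap (hC' ▸ h.mul hiκ)
  obtain ⟨R, hR⟩ := Rat.exists_intCast_of_squarefree_mul_sq
    (hsf.squarefree_of_dvd (Dvd.intro_left e rfl)) hA
  obtain ⟨S, hS⟩ := Rat.exists_intCast_of_squarefree_mul_sq hsf hB
  have h4 : D * (R ^ 2 + e * S ^ 2) = 4 * C := by
    have : (D : ℚ) * (R ^ 2 + e * S ^ 2) = 4 * C := by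
      rw [← hR, ← hS, ← hC]
      ring
    exact_mod_cast this
  obtain ⟨⟨m, hm⟩, ⟨k, hk⟩⟩ := Int.even_of_four_dvd_mul_sq_add hD he ⟨C, h4⟩
  refine ⟨m, k, ?_, ?_⟩
  · rw [hm] at hR; push_cast at hR; linarith
  · rw [hk] at hS; push_cast at hS; linarith

end Integrality

section Span

variable {n : ℕ} {F : Type*} [Field F] (p : Fin n → Prop) [DecidablePred p] {l : Fin n}

theorem sum_eq_sum_ite_add_conjIndex (hl : ¬ p l) {M : Type*} [AddCommMonoid M]
    (f : (Fin n → Fin 2) → M) :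
    ∑ s, f s = ∑ s, if s l = 0 then f s + f (conjIndex p s) else 0 := by
  have hinv : Function.Involutive (conjIndex p) := conjIndex_conjIndex p
  have h1 : ∀ s : Fin n → Fin 2, f s = (if s l = 0 then f s else 0) +
      if conjIndex p s l = 0 then f s else 0 := by
    intro s
    have : conjIndex p s l = 1 - s l := by simp [conjIndex, hl]
    rw [this]
    generalize s l = j
    fin_cases j <;> simp
  have h2 : ∑ s, (if conjIndex p s l = 0 then f s else 0) =
      ∑ s, if s l = 0 then f (conjIndex p s) else 0 := by
    rw [← Equiv.sum_comp hinv.toPerm]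
    simp [conjIndex_conjIndex]
  rw [Finset.sum_congr rfl fun s _ => h1 s, Finset.sum_add_distrib, h2, ← Finset.sum_add_distrib]
  refine Finset.sum_congr rfl fun s _ => ?_
  split_ifs <;> simp

theorem mem_span_realFamily (hl : ¬ p l) (r : Fin n → F) (a : F) (m k : (Fin n → Fin 2) → ℤ)
    (hm : ∀ s, m (conjIndex p s) = m s) (hk : ∀ s, k (conjIndex p s) = -k s) :
    ∑ s, (m s + k s * a) * signBasis r s ∈
      Submodule.span ℤ (Set.range (realFamily p l r a)) := by
  rw [sum_eq_sum_ite_add_conjIndex p hl]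
  refine Submodule.sum_mem _ fun s _ => ?_
  split_ifs with h
  · have hs : Function.update s l 0 = s := by rw [← h, Function.update_eq_self]
    have e : (m s + k s * a) * signBasis r s +
        (m (conjIndex p s) + k (conjIndex p s) * a) * signBasis r (conjIndex p s) =
        m s • realFamily p l r a s + k s • realFamily p l r a (Function.update s l 1) := by
      rw [realFamily, realFamily, Function.update_idem, hs, h, hm, hk, signBasis_conjFamily]
      simp [zsmul_eq_mul]
      ring
    rw [e]
    exact add_mem (Submodule.smul_mem _ _ (Submodule.subset_span ⟨_, rfl⟩))
      (Submodule.smul_mem _ _ (Submodule.subset_span ⟨_, rfl⟩))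
  · exact zero_mem _

theorem mem_span_imagFamily (hl : ¬ p l) (r : Fin n → F) (a : F) (m k : (Fin n → Fin 2) → ℤ)
    (hm : ∀ s, m (conjIndex p s) = -m s) (hk : ∀ s, k (conjIndex p s) = k s) :
    ∑ s, (m s + k s * a) * signBasis r s ∈
      Submodule.span ℤ (Set.range (imagFamily p l r a)) := by
  rw [sum_eq_sum_ite_add_conjIndex p hl]
  refine Submodule.sum_mem _ fun s _ => ?_
  split_ifs with h
  · have hs : Function.update s l 0 = s := by rw [← h, Function.update_eq_self]
    have hsgn : ((-1 : F) ^ (∑ i, (s i : ℕ))) ^ 2 = 1 := by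
      rw [← pow_mul, mul_comm, pow_mul, neg_one_sq, one_pow]
    have e : (m s + k s * a) * signBasis r s +
        (m (conjIndex p s) + k (conjIndex p s) * a) * signBasis r (conjIndex p s) =
        ((-1) ^ (∑ i, (s i : ℕ)) * m s) • imagFamily p l r a (Function.update s l 1) +
          ((-1) ^ (∑ i, (s i : ℕ)) * k s) • imagFamily p l r a s := by
      rw [imagFamily, imagFamily, Function.update_idem, hs, h, hm, hk, signDual_eq_sign_mul,
        signDual_eq_sign_mul, signBasis_conjFamily]
      simp [zsmul_eq_mul]
      linear_combination (-(m s + k s * a) * signBasis r s +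
        (m s - k s * a) * signBasis r (conjIndex p s)) * hsgn
    rw [e]
    exact add_mem (Submodule.smul_mem _ _ (Submodule.subset_span ⟨_, rfl⟩))
      (Submodule.smul_mem _ _ (Submodule.subset_span ⟨_, rfl⟩))
  · exact zero_mem _

end Span

section Coefficients

variable {n : ℕ} {F : Type*} [Field F] [Algebra ℚ F]

/-- The rational part of the coefficient of `x` at `signBasis r s`. -/
noncomputable def coeffOne (r : Fin n → F) (x : F) (s : Fin n → Fin 2) : ℚ :=
  Algebra.trace ℚ F (x * signBasis (fun i => (r i)⁻¹) s) / 2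

/-- The rational factor of `a` in the coefficient of `x` at `signBasis r s`. -/
noncomputable def coeffTwo (r : Fin n → F) (a x : F) (s : Fin n → Fin 2) : ℚ :=
  Algebra.trace ℚ F (x * signBasis (fun i => (r i)⁻¹) s * a⁻¹) / 2

theorem AlgEquiv.apply_eq_or_eq_neg_of_sq_eq_intCast (g : F ≃ₐ[ℚ] F) {z : F} {q : ℤ}
    (hz : z ^ 2 = q) : g z = z ∨ g z = -z := by
  rw [← sq_eq_sq_iff_eq_or_eq_neg, ← map_pow, hz, map_intCast]

theorem coeffOne_conjIndex (p : Fin n → Prop) [DecidablePred p] {r : Fin n → F} (κ : F ≃ₐ[ℚ] F)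
    (hκr : ∀ i, κ (r i) = conjFamily p r i) {x : F} {ε : ℤ} (hx : κ x = ε * x)
    (s : Fin n → Fin 2) : ε * coeffOne r x (conjIndex p s) = coeffOne r x s := by
  have hδ : κ (signBasis (fun i => (r i)⁻¹) s) =
      signBasis (fun i => (r i)⁻¹) (conjIndex p s) := by
    have := map_signBasis (κ : F →+* F) (fun i => (r i)⁻¹) s
    simp only [RingHom.coe_coe, map_inv₀, hκr] at this
    rw [this, ← conjFamily_inv, signBasis_conjFamily]
  rw [coeffOne, coeffOne, ← Algebra.trace_eq_of_algEquiv κ (x * signBasis _ s), map_mul κ, hδ, hx, mul_assoc,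
    ← zsmul_eq_mul (x * _), map_zsmul, zsmul_eq_mul, mul_div_assoc]

theorem coeffTwo_conjIndex (p : Fin n → Prop) [DecidablePred p] {r : Fin n → F} (κ : F ≃ₐ[ℚ] F)
    (hκr : ∀ i, κ (r i) = conjFamily p r i) {a : F} (hκa : κ a = -a) {x : F} {ε : ℤ}
    (hx : κ x = ε * x) (s : Fin n → Fin 2) :
    -ε * coeffTwo r a x (conjIndex p s) = coeffTwo r a x s := by
  have hx' : κ (x * a⁻¹) = (-ε : ℤ) * (x * a⁻¹) := by
    rw [map_mul, map_inv₀, hκa, hx, inv_neg]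
    push_cast
    ring
  have h := coeffOne_conjIndex p κ hκr hx' s
  simp only [coeffOne, mul_right_comm x a⁻¹] at h
  rw [coeffTwo, coeffTwo, ← h]
  push_cast
  ring

variable [FiniteDimensional ℚ F] [IsGalois ℚ F]

theorem coeffOne_add_coeffTwo_mul (r : Fin n → F) (a x : F) (s : Fin n → Fin 2) :
    algebraMap ℚ F (coeffOne r x s) + algebraMap ℚ F (coeffTwo r a x s) * a =
      ∑ g : F ≃ₐ[ℚ] F, g (x * signBasis (fun i => (r i)⁻¹) s) * ((1 + a / g a) / 2) := by
  rw [coeffOne, coeffTwo, map_div₀, map_div₀, trace_eq_sum_automorphisms,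
    trace_eq_sum_automorphisms, Finset.sum_div, Finset.sum_div, Finset.sum_mul,
    ← Finset.sum_add_distrib]
  refine Finset.sum_congr rfl fun g _ => ?_
  rw [map_mul g (x * _), map_inv₀, map_ofNat]
  ring

theorem sum_coeff_mul_signBasis {r : Fin n → F} {q : Fin n → ℤ} (hrq : ∀ i, r i ^ 2 = q i)
    (hr : ∀ i, r i ≠ 0) {a : F} {e : ℤ} (hae : a ^ 2 = e) (ha : a ≠ 0)
    (hgen : ∀ g : F ≃ₐ[ℚ] F, (∀ i, g (r i) = r i) → g a = a → g = 1) (x : F) :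
    ∑ s, (algebraMap ℚ F (coeffOne r x s) + algebraMap ℚ F (coeffTwo r a x s) * a) *
      signBasis r s = x := by
  have := algebraRat.charZero F
  simp only [coeffOne_add_coeffTwo_mul, Finset.sum_mul]
  rw [Finset.sum_comm]
  have key : ∀ g : F ≃ₐ[ℚ] F, ∑ s, g (x * signBasis (fun i => (r i)⁻¹) s) *
      ((1 + a / g a) / 2) * signBasis r s =
      g x * ((1 + a / g a) / 2) * ∏ i, (1 + r i * (g (r i))⁻¹) / 2 := by
    intro g
    rw [← sum_signBasis_mul_signBasis, Finset.mul_sum]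
    refine Finset.sum_congr rfl fun s _ => ?_
    have := map_signBasis (g : F →+* F) (fun i => (r i)⁻¹) s
    simp only [RingHom.coe_coe, map_inv₀] at this
    rw [map_mul, this]
    ring
  simp only [key]
  rw [Finset.sum_eq_single 1]
  · simp [ha, hr]
  · intro g _ hg
    by_contra hne
    refine hg (hgen g (fun i => ?_) ?_)
    · refine (g.apply_eq_or_eq_neg_of_sq_eq_intCast (hrq i)).resolve_right fun h => hne ?_
      rw [Finset.prod_eq_zero (Finset.mem_univ i) (by rw [h, inv_neg, mul_neg,
        mul_inv_cancel₀ (hr i), add_neg_cancel, zero_div]), mul_zero]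
    · refine (g.apply_eq_or_eq_neg_of_sq_eq_intCast hae).resolve_right fun h => hne ?_
      rw [h, div_neg, div_self ha, add_neg_cancel, zero_div, mul_zero, zero_mul]
  · simp

theorem isIntegral_prod_mul_coeff {r : Fin n → F} {D : ℤ} (hP : (∏ i, r i) ^ 2 = D)
    (hr : ∀ i, r i ≠ 0) {a : F} {e : ℤ} (hae : a ^ 2 = e) (ha : a ≠ 0) {x : F}
    (hx : IsIntegral ℤ x) {s : Fin n → Fin 2} (hs : IsIntegral ℤ (signDual r s)) :
    IsIntegral ℤ ((∏ i, r i) *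
      (algebraMap ℚ F (coeffOne r x s) + algebraMap ℚ F (coeffTwo r a x s) * a)) := by
  have := algebraRat.charZero F
  rw [coeffOne_add_coeffTwo_mul, Finset.mul_sum]
  refine IsIntegral.sum _ fun g _ => ?_
  have hP0 : ∏ i, r i ≠ 0 := Finset.prod_ne_zero_iff.2 fun i _ => hr i
  have hg : IsIntegral ℤ (g (x * signDual r s)) :=
    (hx.mul hs).map (g.toAlgHom.restrictScalars ℤ)
  rw [signDual_eq_prod_mul r hr, mul_left_comm, map_mul] at hg
  have hu : IsIntegral ℤ ((∏ i, r i) * g (x * signBasis (fun i => (r i)⁻¹) s)) := by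
    rcases g.apply_eq_or_eq_neg_of_sq_eq_intCast hP with h | h <;> rw [h] at hg
    · exact hg
    · simpa using hg.neg
  rcases g.apply_eq_or_eq_neg_of_sq_eq_intCast hae with h | h
  · rw [h, div_self ha]
    norm_num only [one_add_one_eq_two, div_self, mul_one, ne_eq, OfNat.ofNat_ne_zero, not_false_eq_true]
    exact hu
  · rw [h, div_neg, div_self ha]
    simp [isIntegral_zero]

end Coefficients

section Galois

variable {F : Type*} [Field F] [Algebra ℚ F] [FiniteDimensional ℚ F] [IsGalois ℚ F]

/-- If no nonempty subproduct of the integers `q i` is a square, then all sign changes of their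
square roots are realized by automorphisms. -/
theorem exists_algEquiv_of_forall_not_isSquare {ι : Type*} [Fintype ι] (ρ : ι → F) (q : ι → ℤ)
    (hρ : ∀ i, ρ i ^ 2 = q i) (hq : ∀ S : Finset ι, S.Nonempty → ¬ IsSquare (∏ i ∈ S, q i))
    (μ : ι → Fin 2) : ∃ g : F ≃ₐ[ℚ] F, ∀ i, g (ρ i) = (-1) ^ (μ i : ℕ) * ρ i := by
  classical
  have := algebraRat.charZero F
  have hz : ∀ j : ZMod 2, j = 0 ∨ j = 1 := by decide
  let R : Submodule (ZMod 2) (ι → ZMod 2) :=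
    { carrier := {v | ∃ g : F ≃ₐ[ℚ] F, ∀ i, g (ρ i) = (-1) ^ (v i).val * ρ i}
      zero_mem' := ⟨1, by simp⟩
      add_mem' := by
        rintro v w ⟨g, hg⟩ ⟨h, hh⟩
        refine ⟨g * h, fun i => ?_⟩
        simp only [AlgEquiv.mul_apply, hh, map_mul, map_pow, map_neg, map_one, hg, Pi.add_apply]
        rcases hz (v i) with hv | hv <;> rcases hz (w i) with hw | hw <;> rw [hv, hw] <;>
          simp [ZMod.val_one, show (1 + 1 : ZMod 2) = 0 from rfl]
      smul_mem' := by
        rintro c v ⟨g, hg⟩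
        rcases hz c with rfl | rfl
        · exact ⟨1, by simp⟩
        · exact ⟨g, by simpa using hg⟩ }
  have hR : R = ⊤ := by
    by_contra hne
    obtain ⟨f, hf0, hf⟩ := Submodule.exists_le_ker_of_lt_top R (lt_top_iff_ne_top.2 hne)
    let S := Finset.univ.filter fun i => f (Pi.single i 1) = 1
    have hfv : ∀ v, f v = ∑ i ∈ S, v i := by
      intro v
      conv_lhs => rw [← Finset.univ_sum_single v]
      rw [map_sum, Finset.sum_filter]
      refine Finset.sum_congr rfl fun i _ => ?_
      rw [show (Pi.single i (v i) : ι → ZMod 2) = v i • Pi.single i 1 by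
        rw [← Pi.single_smul, smul_eq_mul, mul_one], map_smul, smul_eq_mul]
      rcases hz (f (Pi.single i 1)) with h | h <;> simp [h]
    have hS : S.Nonempty := by
      by_contra hS
      rw [Finset.not_nonempty_iff_eq_empty] at hS
      exact hf0 (LinearMap.ext fun v => by simp [hfv, hS])
    have hfix : ∀ g : F ≃ₐ[ℚ] F, g (∏ i ∈ S, ρ i) = ∏ i ∈ S, ρ i := by
      intro g
      have hsgn : ∀ i, ∃ c : ZMod 2, g (ρ i) = (-1) ^ c.val * ρ i := by
        intro i
        rcases g.apply_eq_or_eq_neg_of_sq_eq_intCast (hρ i) with h | h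
        · exact ⟨0, by simpa using h⟩
        · exact ⟨1, by simpa [ZMod.val_one] using h⟩
      choose v hv using hsgn
      have hvR : f v = 0 := hf (show v ∈ R from ⟨g, hv⟩)
      rw [map_prod, Finset.prod_congr rfl fun i _ => hv i, Finset.prod_mul_distrib,
        Finset.prod_pow_eq_pow_sum]
      have heven : Even (∑ i ∈ S, (v i).val) := by
        rw [← ZMod.natCast_eq_zero_iff_even]
        push_cast
        simpa [hfv] using hvR
      rw [heven.neg_one_pow, one_mul]
    obtain ⟨x, hx⟩ := (IsGalois.mem_range_algebraMap_iff_fixed _).2 hfix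
    apply hq S hS
    rw [← Rat.isSquare_intCast_iff]
    refine ⟨x, (algebraMap ℚ F).injective ?_⟩
    rw [map_mul, hx, ← Finset.prod_mul_distrib]
    simp [← hρ, pow_two]
  obtain ⟨g, hg⟩ : (fun i => ((μ i : ℕ) : ZMod 2)) ∈ R := hR ▸ Submodule.mem_top
  refine ⟨g, fun i => ?_⟩
  rw [hg, ZMod.val_natCast, Nat.mod_eq_of_lt (μ i).isLt]

end Galois

section IntegralElements

variable {F : Type*} [Field F]

theorem isIntegral_add_div_two [CharZero F] {z c : F} {q : ℤ} (hz : z ^ 2 = q) (hq : q % 4 = 1)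
    (hc : c = 1 ∨ c = -1) : IsIntegral ℤ ((c + z) / 2) := by
  have h1 : IsIntegral ℤ ((1 + z) / 2) := by
    refine ⟨Polynomial.X ^ 2 - Polynomial.X - Polynomial.C (q / 4), by monicity!, ?_⟩
    have hq' : (q : F) = 4 * (q / 4 : ℤ) + 1 := by
      exact_mod_cast (by omega : q = 4 * (q / 4) + 1)
    simp only [Polynomial.eval₂_sub, Polynomial.eval₂_pow, Polynomial.eval₂_X, Polynomial.eval₂_C]
    rw [eq_intCast]
    linear_combination (hz + hq') / 4
  rcases hc with rfl | rfl
  · exact h1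
  · rw [show (-1 + z) / 2 = (1 + z) / 2 - 1 by ring]
    exact h1.sub isIntegral_one

theorem isIntegral_signDual [CharZero F] {n : ℕ} {r : Fin n → F} {q : Fin n → ℤ}
    (hrq : ∀ i, r i ^ 2 = q i) (hq : ∀ i, q i % 4 = 1) (s : Fin n → Fin 2) :
    IsIntegral ℤ (signDual r s) :=
  IsIntegral.prod _ fun i _ => isIntegral_add_div_two (hrq i) (hq i) (neg_one_pow_eq_or F _)

theorem isIntegral_signBasis [CharZero F] {n : ℕ} {r : Fin n → F} {q : Fin n → ℤ}
    (hrq : ∀ i, r i ^ 2 = q i) (hq : ∀ i, q i % 4 = 1) (s : Fin n → Fin 2) :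
    IsIntegral ℤ (signBasis r s) := by
  have h := (isIntegral_signDual hrq hq s).mul
    ((isIntegral_one (R := ℤ) (B := F)).neg.pow (∑ i, (s i : ℕ)))
  rw [signDual_eq_sign_mul, mul_right_comm, ← mul_pow] at h
  simpa using h

theorem conjFamily_sq {n : ℕ} (p : Fin n → Prop) [DecidablePred p] {r : Fin n → F} {q : Fin n → ℤ}
    (hrq : ∀ i, r i ^ 2 = q i) (i : Fin n) : conjFamily p r i ^ 2 = q i := by
  by_cases h : p i <;> simp [conjFamily, h, hrq]

end IntegralElements

section Main

variable {n : ℕ} {F : Type*} [Field F] [Algebra ℚ F] [FiniteDimensional ℚ F] [IsGalois ℚ F]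
  (p : Fin n → Prop) [DecidablePred p] {l : Fin n}

/-- Expansion of an integral element in the integral basis `signBasis r s`, `a * signBasis r s`,
together with the symmetry of the coefficients under an automorphism `κ`. -/
theorem exists_intCast_expansion {r : Fin n → F} {q : Fin n → ℤ} (hrq : ∀ i, r i ^ 2 = q i)
    (hr : ∀ i, r i ≠ 0) (hq : ∀ i, q i % 4 = 1) {a : F} {e : ℤ} (hae : a ^ 2 = -e)
    (he : e = 1 ∨ e = 2) (hsf : Squarefree (e * ∏ i, q i))
    (hgen : ∀ g : F ≃ₐ[ℚ] F, (∀ i, g (r i) = r i) → g a = a → g = 1)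
    (κ : F ≃ₐ[ℚ] F) (hκr : ∀ i, κ (r i) = conjFamily p r i) (hκa : κ a = -a)
    (hP : ∏ i, conjFamily p r i = ∏ i, r i) {x : F} (hx : IsIntegral ℤ x) {ε : ℤ}
    (hε : ε * ε = 1) (hκx : κ x = ε * x) :
    ∃ m k : (Fin n → Fin 2) → ℤ, ∑ s, (m s + k s * a) * signBasis r s = x ∧
      (∀ s, m (conjIndex p s) = ε * m s) ∧ ∀ s, k (conjIndex p s) = -(ε * k s) := by
  have := algebraRat.charZero F
  have ha : a ≠ 0 := by
    rintro rfl
    rcases he with rfl | rfl <;> norm_num at hae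
  have hae' : a ^ 2 = ((-e : ℤ) : F) := by rw [hae]; push_cast; rfl
  have hP2 : (∏ i, r i) ^ 2 = ((∏ i, q i : ℤ) : F) := by
    rw [← Finset.prod_pow]
    simp [hrq]
  have hodd : Odd (∏ i, q i) :=
    Finset.prod_induction _ Odd (fun _ _ => Odd.mul) odd_one fun i _ =>
      Int.odd_iff.2 (by have := hq i; omega)
  have hint := fun s => exists_intCast_coeff hodd hsf he hP2 hae κ (by rw [map_prod, ← hP]; simp [hκr])
    hκa (isIntegral_prod_mul_coeff hP2 hr hae' ha hx (isIntegral_signDual hrq hq s))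
  choose m k hm hk using hint
  refine ⟨m, k, ?_, fun s => ?_, fun s => ?_⟩
  · conv_rhs => rw [← sum_coeff_mul_signBasis hrq hr hae' ha hgen x]
    simp [hm, hk]
  · have h := coeffOne_conjIndex p κ hκr hκx s
    rw [hm, hm] at h
    have h' : ε * m (conjIndex p s) = m s := by exact_mod_cast h
    rw [← h', ← mul_assoc, hε, one_mul]
  · have h := coeffTwo_conjIndex p κ hκr hκa hκx s
    rw [hk, hk] at h
    have h' : -ε * k (conjIndex p s) = k s := by exact_mod_cast h
    linear_combination (-ε) * h' - k (conjIndex p s) * hε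

end Main

section Csqrt

theorem csqrt_sq (x : ℝ) : csqrt x ^ 2 = x := by
  unfold csqrt
  split_ifs with h
  · rw [mul_pow, Complex.I_sq, ← Complex.ofReal_pow, Real.sq_sqrt (by linarith)]
    push_cast
    ring
  · rw [← Complex.ofReal_pow, Real.sq_sqrt (not_lt.1 h)]

theorem conj_csqrt_of_neg {x : ℝ} (h : x < 0) : (starRingEnd ℂ) (csqrt x) = -csqrt x := by
  simp [csqrt, h]

theorem conj_csqrt_of_pos {x : ℝ} (h : 0 < x) : (starRingEnd ℂ) (csqrt x) = csqrt x := by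
  simp [csqrt, h.not_gt]

theorem two_mul_csqrt_div_four (x : ℝ) : 2 * csqrt (x / 4) = csqrt x := by
  have h4 : √(4 : ℝ) = 2 := by
    rw [show (4 : ℝ) = 2 ^ 2 by norm_num]
    exact Real.sqrt_sq (by norm_num)
  by_cases h : x < 0
  · have h' : x / 4 < 0 := by linarith
    rw [csqrt, csqrt, if_pos h, if_pos h', ← neg_div, Real.sqrt_div' _ (by norm_num), h4]
    push_cast
    ring
  · have h' : ¬ x / 4 < 0 := by linarith
    rw [csqrt, csqrt, if_neg h, if_neg h', Real.sqrt_div' _ (by norm_num), h4]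
    push_cast
    ring

theorem Complex.conj_eq_self_of_sq_eq_pos {z : ℂ} {D : ℝ} (hD : 0 < D) (h : z ^ 2 = D) :
    (starRingEnd ℂ) z = z := by
  have hre := congrArg Complex.re h
  have him := congrArg Complex.im h
  simp only [pow_two, Complex.mul_re, Complex.mul_im, Complex.ofReal_re, Complex.ofReal_im]
    at hre him
  rw [Complex.conj_eq_iff_im]
  have h0 : z.re * z.im = 0 := by linarith
  rcases mul_eq_zero.1 h0 with h | h
  · rw [h] at hre
    nlinarith [mul_self_nonneg z.im]
  · exact h

end Csqrt

section Multiquadratic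

variable {ι : Type*} (Q : ι → ℤ) {K : IntermediateField ℚ ℂ}

theorem isIntegral_of_sq_eq_intCast {R L : Type*} [CommRing R] [CommRing L] [Algebra R L] {z : L}
    {q : ℤ} (hz : z ^ 2 = q) : IsIntegral R z := by
  refine IsIntegral.of_pow two_pos ?_
  rw [hz, ← map_intCast (algebraMap R L)]
  exact isIntegral_algebraMap

theorem finiteDimensional_of_eq_adjoin_csqrt [Finite ι]
    (hK : K = IntermediateField.adjoin ℚ (Set.range fun i => csqrt (Q i : ℝ))) :
    FiniteDimensional ℚ K := by
  subst hK
  refine IntermediateField.finiteDimensional_adjoin ?_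
  rintro _ ⟨i, rfl⟩
  exact isIntegral_of_sq_eq_intCast (q := Q i) (by rw [csqrt_sq]; simp)

theorem isGalois_of_eq_adjoin_csqrt [Finite ι]
    (hK : K = IntermediateField.adjoin ℚ (Set.range fun i => csqrt (Q i : ℝ))) :
    IsGalois ℚ K := by
  have := finiteDimensional_of_eq_adjoin_csqrt Q hK
  have hint : ∀ i, IsIntegral ℚ (csqrt (Q i : ℝ)) := fun i =>
    isIntegral_of_sq_eq_intCast (q := Q i) (by rw [csqrt_sq]; simp)
  have hnormal : Normal ℚ K := by
    rw [normal_iff]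
    intro x
    have hx := hK.le x.2
    rw [← isIntegral_algebraMap_iff (algebraMap K ℂ).injective, ← minpoly.algebraMap_eq
      (algebraMap K ℂ).injective]
    have hsplit : ∀ y ∈ Set.range (fun i => csqrt (Q i : ℝ)),
        IsIntegral ℚ y ∧ ((minpoly ℚ y).map (algebraMap ℚ K)).Splits := by
      rintro _ ⟨i, rfl⟩
      refine ⟨hint i, ?_⟩
      let z : K := ⟨csqrt (Q i : ℝ), hK ▸ IntermediateField.subset_adjoin _ _ ⟨i, rfl⟩⟩
      have hz : z ^ 2 = (Q i : K) := Subtype.ext (by simpa [z] using csqrt_sq (Q i : ℝ))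
      have hdvd : minpoly ℚ (csqrt (Q i : ℝ)) ∣ Polynomial.X ^ 2 - Polynomial.C (Q i : ℚ) :=
        minpoly.dvd _ _ (by simpa [sub_eq_zero] using csqrt_sq (Q i : ℝ))
      have hfac : (Polynomial.X ^ 2 - Polynomial.C (Q i : ℚ)).map (algebraMap ℚ K) =
          (Polynomial.X - Polynomial.C z) * (Polynomial.X - Polynomial.C (-z)) := by
        have : (Polynomial.C z) ^ 2 = Polynomial.C (Q i : K) := by rw [← map_pow, hz]
        simp only [Polynomial.map_sub, Polynomial.map_pow, Polynomial.map_X, map_intCast,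
          Polynomial.map_intCast, map_neg] at this ⊢
        linear_combination this
      have hne : (Polynomial.X - Polynomial.C z) * (Polynomial.X - Polynomial.C (-z)) ≠ 0 :=
        mul_ne_zero (Polynomial.X_sub_C_ne_zero _) (Polynomial.X_sub_C_ne_zero _)
      refine Polynomial.Splits.of_dvd ?_ hne
        (hfac ▸ Polynomial.map_dvd (algebraMap ℚ K) hdvd)
      exact (Polynomial.Splits.X_sub_C _).mul (Polynomial.Splits.X_sub_C _)
    exact ⟨(isIntegral_algebraMap_iff (algebraMap K ℂ).injective).2 (Algebra.IsIntegral.isIntegral x),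
      IntermediateField.splits_of_mem_adjoin ℚ ℂ hsplit hx⟩
  exact IsGalois.mk

theorem algEquiv_eq_one_of_fixes_csqrt
    (hK : K = IntermediateField.adjoin ℚ (Set.range fun i => csqrt (Q i : ℝ))) (g : K ≃ₐ[ℚ] K)
    (hg : ∀ (i : ι) (x : K), (x : ℂ) = csqrt (Q i : ℝ) → g x = x) : g = 1 := by
  have h : (g : K →ₐ[ℚ] K) = AlgHom.id ℚ K := by
    refine IntermediateField.algHom_ext_of_eq_adjoin ℚ hK ?_
    rintro x ⟨i, hi⟩
    exact hg i _ hi.symm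
  exact AlgEquiv.ext fun x => DFunLike.congr_fun h x

theorem exists_algEquiv_coe_eq_conj [IsGalois ℚ K] :
    ∃ κ : K ≃ₐ[ℚ] K, ∀ x : K, (κ x : ℂ) = (starRingEnd ℂ) x :=
  ⟨(Complex.conjAe.restrictScalars ℚ).restrictNormal K, fun x =>
    (Complex.conjAe.restrictScalars ℚ).restrictNormal_commutes K x⟩

end Multiquadratic

section Transfer

variable {ι : Type*} {M : IntermediateField ℚ ℂ} (κ : M ≃ₐ[ℚ] M) {b : ι → M}

theorem isIntBasisReal_coe (hκ : ∀ x : M, (κ x : ℂ) = (starRingEnd ℂ) x)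
    (hint : ∀ s, IsIntegral ℤ (b s)) (hfix : ∀ s, κ (b s) = b s)
    (hli : LinearIndependent ℤ b)
    (hspan : ∀ x : M, IsIntegral ℤ x → κ x = x → x ∈ Submodule.span ℤ (Set.range b)) :
    IsIntBasisReal M fun s => (b s : ℂ) := by
  let f : M →ₗ[ℤ] ℂ := (M.val.toLinearMap).restrictScalars ℤ
  refine ⟨fun s => (b s).2, fun s => (hint s).map (M.val.restrictScalars ℤ), fun s => ?_,
    hli.map' f (LinearMap.ker_eq_bot.2 Subtype.val_injective), fun x hx hi him => ?_⟩
  · rw [← Complex.conj_eq_iff_im, ← hκ, hfix]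
  · have h := hspan ⟨x, hx⟩
      ((isIntegral_algebraMap_iff (A := M) (B := ℂ) (algebraMap M ℂ).injective).1 hi)
      (Subtype.ext (by rw [hκ]; exact Complex.conj_eq_iff_im.2 him))
    have h' := Submodule.mem_map_of_mem (f := f) h
    rwa [Submodule.map_span, ← Set.range_comp] at h'

theorem isIntBasisImag_coe (hκ : ∀ x : M, (κ x : ℂ) = (starRingEnd ℂ) x)
    (hint : ∀ s, IsIntegral ℤ (b s)) (hneg : ∀ s, κ (b s) = -b s)
    (hli : LinearIndependent ℤ b)
    (hspan : ∀ x : M, IsIntegral ℤ x → κ x = -x → x ∈ Submodule.span ℤ (Set.range b)) :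
    IsIntBasisImag M fun s => (b s : ℂ) := by
  let f : M →ₗ[ℤ] ℂ := (M.val.toLinearMap).restrictScalars ℤ
  refine ⟨fun s => (b s).2, fun s => (hint s).map (M.val.restrictScalars ℤ), fun s => ?_,
    hli.map' f (LinearMap.ker_eq_bot.2 Subtype.val_injective), fun x hx hi hre => ?_⟩
  · have h := congrArg Complex.re (hκ (b s))
    rw [hneg] at h
    simp at h
    linarith
  · have h := hspan ⟨x, hx⟩
      ((isIntegral_algebraMap_iff (A := M) (B := ℂ) (algebraMap M ℂ).injective).1 hi)
      (Subtype.ext (by rw [hκ]; apply Complex.ext <;> simp [hre]))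
    have h' := Submodule.mem_map_of_mem (f := f) h
    rwa [Submodule.map_span, ← Set.range_comp] at h'

end Transfer

section Symmetry

variable {n : ℕ} {F : Type*} [Field F] (p : Fin n → Prop) [DecidablePred p]

theorem conjFamily_conjFamily (r : Fin n → F) : conjFamily p (conjFamily p r) = r := by
  funext i
  by_cases h : p i <;> simp [conjFamily, h]

theorem realFamily_conjFamily_neg (l : Fin n) (r : Fin n → F) (a : F) (s : Fin n → Fin 2) :
    realFamily p l (conjFamily p r) (-a) s = realFamily p l r a s := by
  rw [realFamily, realFamily, conjFamily_conjFamily, neg_neg, add_comm]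

theorem imagFamily_conjFamily_neg (l : Fin n) (r : Fin n → F) (a : F) (s : Fin n → Fin 2) :
    imagFamily p l (conjFamily p r) (-a) s = -imagFamily p l r a s := by
  rw [imagFamily, imagFamily, conjFamily_conjFamily, neg_neg, neg_sub]

variable [CharZero F] {q : Fin n → ℤ} {r : Fin n → F} {a : F}

theorem isIntegral_realFamily (hrq : ∀ i, r i ^ 2 = q i) (hq : ∀ i, q i % 4 = 1)
    (ha : IsIntegral ℤ a) (l : Fin n) (s : Fin n → Fin 2) :
    IsIntegral ℤ (realFamily p l r a s) :=
  ((isIntegral_signBasis hrq hq _).mul (ha.pow _)).add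
    ((isIntegral_signBasis (conjFamily_sq p hrq) hq _).mul (ha.neg.pow _))

theorem isIntegral_imagFamily (hrq : ∀ i, r i ^ 2 = q i) (hq : ∀ i, q i % 4 = 1)
    (ha : IsIntegral ℤ a) (l : Fin n) (s : Fin n → Fin 2) :
    IsIntegral ℤ (imagFamily p l r a s) :=
  ((isIntegral_signDual hrq hq _).mul (ha.pow _)).sub
    ((isIntegral_signDual (conjFamily_sq p hrq) hq _).mul (ha.neg.pow _))

end Symmetry

section ExplicitProducts

theorem prod_ite_lt_mul_prod_ite_mul {n u : ℕ} {M : Type*} [CommMonoid M] (l : Fin n)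
    (hl : (l : ℕ) + 1 = n) (hu : u ≤ l) (f g : Fin n → M) (b c : M) :
    (∏ i : Fin n, if (i : ℕ) < u then f i else 1) *
        ((∏ i : Fin n, if u ≤ (i : ℕ) ∧ (i : ℕ) + 1 < n then g i else 1) * c * b) =
      (∏ i : Fin n, if (i : ℕ) < u then f i else if i = l then c else g i) * b := by
  have hc : c = ∏ i : Fin n, if i = l then c else 1 := by simp
  conv_lhs => rw [hc]
  rw [← mul_assoc, ← Finset.prod_mul_distrib, ← Finset.prod_mul_distrib]
  refine congrArg (· * b) (Finset.prod_congr rfl fun i _ => ?_)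
  rcases eq_or_ne i l with rfl | hi
  · simp [hu.not_gt, hl]
  · have hi' : (i : ℕ) ≠ l := fun h => hi (Fin.ext h)
    have := i.isLt
    have h1 : (i : ℕ) + 1 < n := by omega
    by_cases h : (i : ℕ) < u
    · simp [h, h.not_ge, hi]
    · simp [h, not_lt.1 h, hi, h1]

variable {n u : ℕ} {F : Type*} [Field F] {l : Fin n} {r α αbar : Fin n → F}

theorem prod_mul_eq_realFamily (hl : (l : ℕ) + 1 = n) (hu : u ≤ l)
    (hα : ∀ i, α i = (1 + r i) / 2) (hαbar : ∀ i, αbar i = (1 - r i) / 2) (a : F)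
    (s : Fin n → Fin 2) :
    (∏ i : Fin n, if (i : ℕ) < u then αbar i ^ (s i : ℕ) * α i ^ (1 - (s i : ℕ)) else 1) *
        ((∏ i : Fin n, if u ≤ (i : ℕ) ∧ (i : ℕ) + 1 < n then
            αbar i ^ (s i : ℕ) * α i ^ (1 - (s i : ℕ)) else 1) * α l * a ^ (s l : ℕ) +
          (∏ i : Fin n, if u ≤ (i : ℕ) ∧ (i : ℕ) + 1 < n then
            αbar i ^ (1 - (s i : ℕ)) * α i ^ (s i : ℕ) else 1) * αbar l * (-a) ^ (s l : ℕ)) =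
      realFamily (fun i : Fin n => (i : ℕ) < u) l r a s := by
  rw [mul_add, prod_ite_lt_mul_prod_ite_mul l hl hu,
    prod_ite_lt_mul_prod_ite_mul l hl hu, realFamily, signBasis, signBasis]
  congr 2 <;> refine Finset.prod_congr rfl fun i _ => ?_
  all_goals
    rcases eq_or_ne i l with rfl | hi
    · simp [conjFamily, hu.not_gt, hα, hαbar, sub_eq_add_neg]
    · rw [Function.update_of_ne hi]
      generalize s i = j
      by_cases h : (i : ℕ) < u <;> fin_cases j <;>
        simp [conjFamily, h, hi, hα, hαbar, sub_eq_add_neg]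

theorem prod_mul_eq_imagFamily (hl : (l : ℕ) + 1 = n) (hu : u ≤ l)
    (hα : ∀ i, α i = (1 + r i) / 2) (hαbar : ∀ i, αbar i = (1 - r i) / 2) (a : F)
    (s : Fin n → Fin 2) :
    (∏ i : Fin n, if (i : ℕ) < u then (-αbar i) ^ (s i : ℕ) * α i ^ (1 - (s i : ℕ)) else 1) *
        ((∏ i : Fin n, if u ≤ (i : ℕ) ∧ (i : ℕ) + 1 < n then
            (-αbar i) ^ (s i : ℕ) * α i ^ (1 - (s i : ℕ)) else 1) * α l *
            a ^ (1 - (s l : ℕ)) -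
          (∏ i : Fin n, if u ≤ (i : ℕ) ∧ (i : ℕ) + 1 < n then
            αbar i ^ (1 - (s i : ℕ)) * (-α i) ^ (s i : ℕ) else 1) * αbar l *
            (-a) ^ (1 - (s l : ℕ))) =
      imagFamily (fun i : Fin n => (i : ℕ) < u) l r a s := by
  rw [mul_sub, prod_ite_lt_mul_prod_ite_mul l hl hu,
    prod_ite_lt_mul_prod_ite_mul l hl hu, imagFamily, signDual, signDual]
  congr 2 <;> refine Finset.prod_congr rfl fun i _ => ?_
  all_goals
    rcases eq_or_ne i l with rfl | hi
    · simp [conjFamily, hu.not_gt, hα, hαbar, sub_eq_add_neg]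
    · rw [Function.update_of_ne hi]
      generalize s i = j
      by_cases h : (i : ℕ) < u <;> fin_cases j <;>
        simp [conjFamily, h, hi, hα, hαbar] <;> ring

end ExplicitProducts

section PrimeDiscriminants

theorem isPrimeDiscriminant_odd {q : ℤ} (hq : IsPrimeDiscriminant q) (hodd : Odd q) :
    Prime q ∧ q % 4 = 1 := by
  rcases hq with ⟨p, hp, hpo, rfl⟩ | rfl | rfl | rfl
  · obtain ⟨k, rfl⟩ := hpo
    have hp' := Nat.prime_iff_prime_int.1 hp
    rw [show (2 * k + 1 - 1) / 2 = k by omega]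
    rcases Nat.even_or_odd' k with ⟨m, rfl | rfl⟩
    · rw [(even_two_mul m).neg_one_pow, one_mul]
      exact ⟨hp', by push_cast; omega⟩
    · rw [(odd_two_mul_add_one m).neg_one_pow, neg_one_mul]
      exact ⟨hp'.neg, by push_cast; omega⟩
  all_goals exact absurd hodd (by decide)

theorem not_isSquare_prod_of_prime_mem {ι : Type*} {Q : ι → ℤ}
    (hcop : Pairwise fun i j => IsCoprime (Q i) (Q j)) {S : Finset ι} {j : ι} (hj : j ∈ S)
    (hQ : Prime (Q j)) : ¬ IsSquare (∏ i ∈ S, Q i) := by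
  classical
  rintro ⟨x, hx⟩
  rw [← Finset.mul_prod_erase S Q hj] at hx
  have hdvd : Q j ∣ x := by
    have h : Q j ∣ x * x := ⟨_, hx.symm⟩
    exact (hQ.dvd_or_dvd h).elim id id
  obtain ⟨y, rfl⟩ := hdvd
  have h : ∏ i ∈ S.erase j, Q i = Q j * (y * y) := by
    refine mul_left_cancel₀ hQ.ne_zero ?_
    linear_combination hx
  have hc : IsCoprime (Q j) (∏ i ∈ S.erase j, Q i) :=
    IsCoprime.prod_right fun i hi => hcop (Finset.ne_of_mem_erase hi).symm
  exact hQ.not_isUnit (hc.isUnit_of_dvd' dvd_rfl ⟨_, h⟩)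

variable {n : ℕ} {Q : Fin (n + 1) → ℤ}

theorem not_isSquare_prod_of_odd_castSucc (hQ : ∀ i, IsPrimeDiscriminant (Q i))
    (hcop : Pairwise fun i j => IsCoprime (Q i) (Q j)) (hodd : ∀ i : Fin n, Odd (Q i.castSucc))
    (hlast : Q (Fin.last n) < 0) {S : Finset (Fin (n + 1))} (hS : S.Nonempty) :
    ¬ IsSquare (∏ i ∈ S, Q i) := by
  by_cases h : ∃ i : Fin n, i.castSucc ∈ S
  · obtain ⟨i, hi⟩ := h
    exact not_isSquare_prod_of_prime_mem hcop hi (isPrimeDiscriminant_odd (hQ _) (hodd i)).1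
  · push Not at h
    have : S = {Fin.last n} := by
      refine hS.subset_singleton_iff.1 fun i hi => ?_
      induction i using Fin.lastCases with
      | last => simp
      | cast i => exact absurd hi (h i)
    rw [this, Finset.prod_singleton]
    exact fun hsq => hlast.not_ge hsq.nonneg

theorem squarefree_of_isNegFundamentalDiscriminant {e D : ℤ}
    (hd : IsNegFundamentalDiscriminant (D * (-4 * e))) : Squarefree (e * D) := by
  have h4 : D * (-4 * e) = -(e * D) * 4 := by ring
  obtain ⟨-, ⟨h, -⟩ | ⟨-, h, -⟩⟩ := hd
  · omega
  · rw [h4, Int.mul_ediv_cancel _ (by norm_num)] at h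
    exact h.squarefree_of_dvd (dvd_neg.2 dvd_rfl)

end PrimeDiscriminants

/- Here `t = t' + 1`: the (1-based) indices `1, …, t−1` correspond to `i.castSucc` for
`i : Fin t'`, the index `t` corresponds to `Fin.last t'` (`q_t* ∈ {−4, −8}`), and the
index `t−1` corresponds to `⟨t'−1, _⟩`; sets `s ∈ {0,1}^{t−1}` are functions
`s : Fin t' → Fin 2` (`s_{t−1} = s ⟨t'−1, _⟩`). -/
theorem stmt13 (t' : ℕ) (d : ℤ) (hd : IsNegFundamentalDiscriminant d)
    (Q : Fin (t' + 1) → ℤ) (hQ : ∀ i, IsPrimeDiscriminant (Q i))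
    (hcop : Pairwise fun i j => IsCoprime (Q i) (Q j)) (hprod : d = ∏ i, Q i)
    (hodd : ∀ i : Fin t', Odd (Q i.castSucc))
    (hlast : Q (Fin.last t') = -4 ∨ Q (Fin.last t') = -8)
    (u : ℕ) (hu : u + 1 ≤ t')
    (hsign : ∀ i : Fin (t' + 1), ((i : ℕ) < u → 0 < Q i) ∧ (u ≤ (i : ℕ) → Q i < 0))
    (a abar : Fin (t' + 1) → ℂ)
    (ha : ∀ i : Fin t', a i.castSucc = (1 + csqrt (Q i.castSucc : ℝ)) / 2)
    (habar : ∀ i : Fin t', abar i.castSucc = (1 - csqrt (Q i.castSucc : ℝ)) / 2)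
    (halast : a (Fin.last t') = csqrt ((Q (Fin.last t') : ℝ) / 4))
    -- `K_G = ℚ(√q_1*, …, √q_t*)` generated inside `ℂ`
    (K : IntermediateField ℚ ℂ)
    (hK : K = IntermediateField.adjoin ℚ (Set.range fun i => csqrt (Q i : ℝ)))
    (β βstar : (Fin t' → Fin 2) → ℂ)
    (hβ : ∀ s, β s =
      (∏ i : Fin t', if (i : ℕ) < u then
          abar i.castSucc ^ (s i : ℕ) * a i.castSucc ^ (1 - (s i : ℕ)) else 1) *
        ((∏ i : Fin t', if u ≤ (i : ℕ) ∧ (i : ℕ) + 1 < t' then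
            abar i.castSucc ^ (s i : ℕ) * a i.castSucc ^ (1 - (s i : ℕ)) else 1) *
            a ⟨t' - 1, by omega⟩ * a (Fin.last t') ^ (s ⟨t' - 1, by omega⟩ : ℕ) +
         (∏ i : Fin t', if u ≤ (i : ℕ) ∧ (i : ℕ) + 1 < t' then
            abar i.castSucc ^ (1 - (s i : ℕ)) * a i.castSucc ^ (s i : ℕ) else 1) *
            abar ⟨t' - 1, by omega⟩ * (-a (Fin.last t')) ^ (s ⟨t' - 1, by omega⟩ : ℕ)))
    (hβstar : ∀ s, βstar s =
      (∏ i : Fin t', if (i : ℕ) < u then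
          (-abar i.castSucc) ^ (s i : ℕ) * a i.castSucc ^ (1 - (s i : ℕ)) else 1) *
        ((∏ i : Fin t', if u ≤ (i : ℕ) ∧ (i : ℕ) + 1 < t' then
            (-abar i.castSucc) ^ (s i : ℕ) * a i.castSucc ^ (1 - (s i : ℕ)) else 1) *
            a ⟨t' - 1, by omega⟩ * a (Fin.last t') ^ (1 - (s ⟨t' - 1, by omega⟩ : ℕ)) -
         (∏ i : Fin t', if u ≤ (i : ℕ) ∧ (i : ℕ) + 1 < t' then
            abar i.castSucc ^ (1 - (s i : ℕ)) * (-a i.castSucc) ^ (s i : ℕ) else 1) *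
            abar ⟨t' - 1, by omega⟩ *
              (-a (Fin.last t')) ^ (1 - (s ⟨t' - 1, by omega⟩ : ℕ)))) :
    IsIntBasisReal K β ∧ IsIntBasisImag K βstar ∧
      ∀ τ : (Fin t' → Fin 2) → (K ≃ₐ[ℚ] K),
        (∀ (μ : Fin t' → Fin 2) (i : Fin t') (x : K),
          (x : ℂ) = csqrt (Q i.castSucc : ℝ) →
            ((τ μ x : K) : ℂ) = (-1 : ℂ) ^ (μ i : ℕ) * csqrt (Q i.castSucc : ℝ)) →
        (∀ (μ : Fin t' → Fin 2) (x : K),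
          (x : ℂ) = csqrt (Q (Fin.last t') : ℝ) →
            ((τ μ x : K) : ℂ) = csqrt (Q (Fin.last t') : ℝ)) →
        ∀ η ν : Fin t' → Fin 2, ∀ z : K, (z : ℂ) = β η * βstar ν →
          ∑ μ : Fin t' → Fin 2,
              (-1 : ℂ) ^ (∑ i, (μ i : ℕ)) * ((τ μ z : K) : ℂ) =
            if η = ν then ∏ i, csqrt (Q i : ℝ) else 0 := by
  obtain ⟨l, hl, hlc⟩ : ∃ l : Fin t', l = ⟨t' - 1, by omega⟩ ∧
      (⟨t' - 1, by omega⟩ : Fin (t' + 1)) = l.castSucc := ⟨_, rfl, rfl⟩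
  have hl1 : (l : ℕ) + 1 = t' := by rw [hl, Fin.val_mk]; omega
  have hul : u ≤ (l : ℕ) := by omega
  let p : Fin t' → Prop := fun i => (i : ℕ) < u
  have hlp : ¬ p l := hul.not_gt
  have hlast0 : Q (Fin.last t') < 0 := by rcases hlast with h | h <;> rw [h] <;> norm_num
  obtain ⟨e, he, hQe⟩ : ∃ e : ℤ, (e = 1 ∨ e = 2) ∧ Q (Fin.last t') = -4 * e := by
    rcases hlast with h | h
    · exact ⟨1, Or.inl rfl, by rw [h]; rfl⟩
    · exact ⟨2, Or.inr rfl, by rw [h]; rfl⟩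
  have hdprod : d = (∏ i : Fin t', Q i.castSucc) * (-4 * e) := by
    rw [hprod, Fin.prod_univ_castSucc, hQe]
  have hsf : Squarefree (e * ∏ i : Fin t', Q i.castSucc) :=
    squarefree_of_isNegFundamentalDiscriminant (hdprod ▸ hd)
  have hDpos : 0 < ∏ i : Fin t', Q i.castSucc := by
    have h := hd.1
    rw [hdprod] at h
    exact pos_of_mul_neg_left h (by omega)
  have hq4 : ∀ i : Fin t', Q i.castSucc % 4 = 1 := fun i =>
    (isPrimeDiscriminant_odd (hQ _) (hodd i)).2
  have := finiteDimensional_of_eq_adjoin_csqrt Q hK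
  have := isGalois_of_eq_adjoin_csqrt Q hK
  obtain ⟨κ, hκ⟩ := exists_algEquiv_coe_eq_conj (K := K)
  have hmem : ∀ i, csqrt (Q i : ℝ) ∈ K := fun i =>
    hK ▸ IntermediateField.subset_adjoin _ _ ⟨i, rfl⟩
  let ρ : Fin (t' + 1) → K := fun i => ⟨csqrt (Q i : ℝ), hmem i⟩
  have hρ : ∀ i, ρ i ^ 2 = Q i := fun i => Subtype.ext (by simpa [ρ] using csqrt_sq (Q i : ℝ))
  let r : Fin t' → K := fun i => ρ i.castSucc
  have hrq : ∀ i, r i ^ 2 = (Q i.castSucc : K) := fun i => hρ _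
  have hr : ∀ i, r i ≠ 0 := by
    intro i h
    have h2 := hrq i
    have h4 := hq4 i
    rw [h, zero_pow two_ne_zero, eq_comm, Int.cast_eq_zero] at h2
    omega
  let b : K := ρ (Fin.last t') / 2
  have hb2 : 2 * b = ρ (Fin.last t') := mul_div_cancel₀ _ two_ne_zero
  have hbcoe : (b : ℂ) = a (Fin.last t') := by
    have h : 2 * (b : ℂ) = csqrt (Q (Fin.last t') : ℝ) := congrArg Subtype.val hb2
    rw [halast]
    refine mul_left_cancel₀ (two_ne_zero (α := ℂ)) ?_
    rw [h, two_mul_csqrt_div_four]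
  have hbe : b ^ 2 = -(e : K) := by
    have h := hρ (Fin.last t')
    rw [hQe, ← hb2] at h
    push_cast at h
    linear_combination h / 4
  have hb0 : b ≠ 0 := by
    intro h
    rw [h] at hbe
    rcases he with rfl | rfl <;> norm_num at hbe
  have hκr : ∀ i, κ (r i) = conjFamily p r i := by
    intro i
    apply Subtype.ext
    rw [hκ]
    by_cases h : p i
    · rw [conjFamily, if_pos h]
      exact conj_csqrt_of_pos (by exact_mod_cast (hsign i.castSucc).1 h)
    · rw [conjFamily, if_neg h]
      exact conj_csqrt_of_neg (by exact_mod_cast (hsign i.castSucc).2 (not_lt.1 h))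
  have hκb : κ b = -b := by
    have h : κ (ρ (Fin.last t')) = -ρ (Fin.last t') := by
      apply Subtype.ext
      rw [hκ]
      exact conj_csqrt_of_neg (by exact_mod_cast hlast0)
    rw [map_div₀, h, map_ofNat, neg_div]
  have hP : ∏ i, conjFamily p r i = ∏ i, r i := by
    rw [← Finset.prod_congr rfl fun i _ => hκr i, ← map_prod]
    apply Subtype.ext
    rw [hκ]
    refine Complex.conj_eq_self_of_sq_eq_pos (D := (∏ i : Fin t', Q i.castSucc : ℤ))
      (by exact_mod_cast hDpos) ?_
    have h : (∏ i, r i) ^ 2 = ((∏ i : Fin t', Q i.castSucc : ℤ) : K) := by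
      rw [← Finset.prod_pow, Finset.prod_congr rfl fun i _ => hrq i]
      push_cast
      rfl
    have h' := congrArg (Subtype.val) h
    simpa using h'
  have hgen : ∀ g : K ≃ₐ[ℚ] K, (∀ i, g (r i) = r i) → g b = b → g = 1 := by
    intro g hgr hgb
    refine algEquiv_eq_one_of_fixes_csqrt Q hK g fun i x hx => ?_
    obtain rfl : x = ρ i := Subtype.ext hx
    induction i using Fin.lastCases with
    | last => rw [← hb2, map_mul, hgb, map_ofNat]
    | cast i => exact hgr i
  have hsigns : ∀ μ : Fin t' → Fin 2, ∃ g : K ≃ₐ[ℚ] K,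
      (∀ i, g (r i) = (-1) ^ (μ i : ℕ) * r i) ∧ g b = b := by
    intro μ
    obtain ⟨g, hg⟩ := exists_algEquiv_of_forall_not_isSquare ρ Q hρ
      (fun S hS => not_isSquare_prod_of_odd_castSucc hQ hcop hodd hlast0 hS)
      (Fin.snoc (α := fun _ => Fin 2) μ 0)
    refine ⟨g, fun i => ?_, ?_⟩
    · simpa using hg i.castSucc
    · have h := hg (Fin.last t')
      rw [Fin.snoc_last, Fin.val_zero, pow_zero, one_mul] at h
      rw [map_div₀, h, map_ofNat]
  choose σ hσr hσb using hsigns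
  have hbint : IsIntegral ℤ b := isIntegral_of_sq_eq_intCast (q := -e) (by rw [hbe]; push_cast; rfl)
  have hαr : ∀ i : Fin t', a i.castSucc = (1 + (r i : ℂ)) / 2 := ha
  have hαbarr : ∀ i : Fin t', abar i.castSucc = (1 - (r i : ℂ)) / 2 := habar
  have hβK : β = fun s => ((realFamily p l r b s : K) : ℂ) := by
    funext s
    rw [hβ, hlc, ← hl, prod_mul_eq_realFamily hl1 hul hαr hαbarr, ← hbcoe]
    exact (map_realFamily p (algebraMap K ℂ) l r b s).symm
  have hβstarK : βstar = fun s => ((imagFamily p l r b s : K) : ℂ) := by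
    funext s
    rw [hβstar, hlc, ← hl, prod_mul_eq_imagFamily hl1 hul hαr hαbarr, ← hbcoe]
    exact (map_imagFamily p (algebraMap K ℂ) l r b s).symm
  have hκrfun : (fun i => (κ : K →+* K) (r i)) = conjFamily p r := funext hκr
  refine ⟨?_, ?_, fun τ hτ hτlast η ν z hz => ?_⟩
  · rw [hβK]
    refine isIntBasisReal_coe κ hκ (isIntegral_realFamily p hrq hq4 hbint l) (fun s => ?_)
      (linearIndependent_realFamily p r hr hb0 hlp hP (fun μ => (σ μ : K →+* K)) hσr hσb)
      fun x hx hκx => ?_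
    · have h := map_realFamily p (κ : K →+* K) l r b s
      rw [hκrfun, RingHom.coe_coe, hκb, realFamily_conjFamily_neg] at h
      exact h
    · obtain ⟨m, k, rfl, hm, hk⟩ := exists_intCast_expansion p hrq hr hq4 hbe he hsf hgen κ hκr hκb
        hP hx (ε := 1) (by norm_num) (by simpa using hκx)
      exact mem_span_realFamily p hlp r b m k (by simpa using hm) (by simpa using hk)
  · rw [hβstarK]
    refine isIntBasisImag_coe κ hκ (isIntegral_imagFamily p hrq hq4 hbint l) (fun s => ?_)
      (linearIndependent_imagFamily p r hr hb0 hlp hP (fun μ => (σ μ : K →+* K)) hσr hσb)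
      fun x hx hκx => ?_
    · have h := map_imagFamily p (κ : K →+* K) l r b s
      rw [hκrfun, RingHom.coe_coe, hκb, imagFamily_conjFamily_neg] at h
      exact h
    · obtain ⟨m, k, rfl, hm, hk⟩ := exists_intCast_expansion p hrq hr hq4 hbe he hsf hgen κ hκr hκb
        hP hx (ε := -1) (by norm_num) (by simpa using hκx)
      exact mem_span_imagFamily p hlp r b m k (by simpa using hm) (by simpa using hk)
  · obtain rfl : z = realFamily p l r b η * imagFamily p l r b ν := by
      apply Subtype.ext
      rw [hz, hβK, hβstarK]
      rfl
    have hτr : ∀ μ i, (τ μ : K →+* K) (r i) = (-1) ^ (μ i : ℕ) * r i := fun μ i =>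
      Subtype.ext (by simpa [r, ρ] using hτ μ i (r i) rfl)
    have hτb : ∀ μ, (τ μ : K →+* K) b = b := by
      intro μ
      have h : τ μ (ρ (Fin.last t')) = ρ (Fin.last t') := Subtype.ext (hτlast μ _ rfl)
      rw [RingHom.coe_coe, map_div₀, h, map_ofNat]
    have h := congrArg (algebraMap K ℂ) (sum_twisted_realFamily_mul_imagFamily p r hr b hlp hP
      (fun μ => (τ μ : K →+* K)) hτr hτb η ν)
    rw [hb2, apply_ite (algebraMap K ℂ), map_zero, map_sum, map_mul, map_prod] at h
    rw [Fin.prod_univ_castSucc]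
    simpa using h
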